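/- There exist a constant C > 0 and a valid online rotation strategy σ such that for every nonempty finite stream L of pieces in which every piece has both edge lengths at least 1, ALG_σ(L) ≤ C·OPT(L)^{5/4}, where the cost is the area of the bounding box. (An O(OPT^{1/4})-competitive online algorithm for area minimization with rotations allowed, when all edges are long.) -/

import Mathlib

open Set

/-- A piece is a pair (w,h) of (intended positive) real numbers. -/
abbrev Piece := ℝ × ℝ

/-- Both edge lengths of the piece are positive. -/
def PiecePos (p : Piece) : Prop := 0 < p.1 ∧ 0 < p.2

/-- The axis-parallel closed rectangle obtained by placing piece `p` by
translation at the point `q`. -/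
def placedRect (p : Piece) (q : ℝ × ℝ) : Set (ℝ × ℝ) :=
  Set.Icc q.1 (q.1 + p.1) ×ˢ Set.Icc q.2 (q.2 + p.2)

/-- Width of the axis-parallel bounding box of a set in the plane. -/
noncomputable def boxWidth (S : Set (ℝ × ℝ)) : ℝ :=
  sSup (Prod.fst '' S) - sInf (Prod.fst '' S)

/-- Height of the axis-parallel bounding box of a set in the plane. -/
noncomputable def boxHeight (S : Set (ℝ × ℝ)) : ℝ :=
  sSup (Prod.snd '' S) - sInf (Prod.snd '' S)

/-! ### Translations only -/

/-- `pos` is a packing (by translations) of the list `L` of pieces: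
the placed rectangles have pairwise disjoint interiors. -/
def IsPacking (L : List Piece) (pos : Fin L.length → ℝ × ℝ) : Prop :=
  ∀ i j : Fin L.length, i ≠ j →
    Disjoint (interior (placedRect (L.get i) (pos i)))
             (interior (placedRect (L.get j) (pos j)))

/-- The union of the placed rectangles. -/
def packedSet (L : List Piece) (pos : Fin L.length → ℝ × ℝ) : Set (ℝ × ℝ) :=
  ⋃ i : Fin L.length, placedRect (L.get i) (pos i)

/-- Perimeter of the bounding box of a packing. -/
noncomputable def periCost (L : List Piece) (pos : Fin L.length → ℝ × ℝ) : ℝ :=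
  2 * (boxWidth (packedSet L pos) + boxHeight (packedSet L pos))

/-- Area of the bounding box of a packing. -/
noncomputable def areaCost (L : List Piece) (pos : Fin L.length → ℝ × ℝ) : ℝ :=
  boxWidth (packedSet L pos) * boxHeight (packedSet L pos)

/-- Optimal offline bounding-box perimeter for the pieces of `L`. -/
noncomputable def optPeri (L : List Piece) : ℝ :=
  sInf { c | ∃ pos : Fin L.length → ℝ × ℝ, IsPacking L pos ∧ periCost L pos = c }

/-- Optimal offline bounding-box area for the pieces of `L`. -/
noncomputable def optArea (L : List Piece) : ℝ :=
  sInf { c | ∃ pos : Fin L.length → ℝ × ℝ, IsPacking L pos ∧ areaCost L pos = c }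

/-- The positions chosen by the online strategy `σ` on the stream `L`:
the `i`-th piece is placed at the point chosen by `σ` as a function of the
first `i+1` pieces. -/
def onlinePos (σ : List Piece → ℝ × ℝ) (L : List Piece) :
    Fin L.length → ℝ × ℝ :=
  fun i => σ (L.take ((i : ℕ) + 1))

/-- `σ` is a valid online translation strategy: on every stream of pieces it
produces a packing. -/
def StrategyValid (σ : List Piece → ℝ × ℝ) : Prop :=
  ∀ L : List Piece, (∀ p ∈ L, PiecePos p) → IsPacking L (onlinePos σ L)

/-- Perimeter of the bounding box of the packing produced by `σ` on `L`. -/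
noncomputable def algPeri (σ : List Piece → ℝ × ℝ) (L : List Piece) : ℝ :=
  periCost L (onlinePos σ L)

/-- Area of the bounding box of the packing produced by `σ` on `L`. -/
noncomputable def algArea (σ : List Piece → ℝ × ℝ) (L : List Piece) : ℝ :=
  areaCost L (onlinePos σ L)

/-! ### Rotations by 90° allowed -/

/-- The piece `p` in the orientation given by `r`: rotated by 90° if `r` is
`true`. -/
def orient (p : Piece) (r : Bool) : Piece := if r then (p.2, p.1) else p

/-- `pos, rot` is a packing with rotations of the list `L` of pieces. -/
def IsRotPacking (L : List Piece) (pos : Fin L.length → ℝ × ℝ)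
    (rot : Fin L.length → Bool) : Prop :=
  ∀ i j : Fin L.length, i ≠ j →
    Disjoint (interior (placedRect (orient (L.get i) (rot i)) (pos i)))
             (interior (placedRect (orient (L.get j) (rot j)) (pos j)))

/-- The union of the placed (possibly rotated) rectangles. -/
def packedRotSet (L : List Piece) (pos : Fin L.length → ℝ × ℝ)
    (rot : Fin L.length → Bool) : Set (ℝ × ℝ) :=
  ⋃ i : Fin L.length, placedRect (orient (L.get i) (rot i)) (pos i)

/-- Perimeter of the bounding box of a packing with rotations. -/
noncomputable def periRotCost (L : List Piece) (pos : Fin L.length → ℝ × ℝ)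
    (rot : Fin L.length → Bool) : ℝ :=
  2 * (boxWidth (packedRotSet L pos rot) + boxHeight (packedRotSet L pos rot))

/-- Area of the bounding box of a packing with rotations. -/
noncomputable def areaRotCost (L : List Piece) (pos : Fin L.length → ℝ × ℝ)
    (rot : Fin L.length → Bool) : ℝ :=
  boxWidth (packedRotSet L pos rot) * boxHeight (packedRotSet L pos rot)

/-- Optimal offline bounding-box perimeter with rotations allowed. -/
noncomputable def optRotPeri (L : List Piece) : ℝ :=
  sInf { c | ∃ (pos : Fin L.length → ℝ × ℝ) (rot : Fin L.length → Bool),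
    IsRotPacking L pos rot ∧ periRotCost L pos rot = c }

/-- Optimal offline bounding-box area with rotations allowed. -/
noncomputable def optRotArea (L : List Piece) : ℝ :=
  sInf { c | ∃ (pos : Fin L.length → ℝ × ℝ) (rot : Fin L.length → Bool),
    IsRotPacking L pos rot ∧ areaRotCost L pos rot = c }

/-- The positions chosen by the online rotation strategy `σ` on the stream `L`. -/
def onlineRotPos (σ : List Piece → (ℝ × ℝ) × Bool) (L : List Piece) :
    Fin L.length → ℝ × ℝ :=
  fun i => (σ (L.take ((i : ℕ) + 1))).1

/-- The orientations chosen by the online rotation strategy `σ` on the stream `L`. -/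
def onlineRot (σ : List Piece → (ℝ × ℝ) × Bool) (L : List Piece) :
    Fin L.length → Bool :=
  fun i => (σ (L.take ((i : ℕ) + 1))).2

/-- `σ` is a valid online rotation strategy: on every stream of pieces it
produces a packing with rotations. -/
def RotStrategyValid (σ : List Piece → (ℝ × ℝ) × Bool) : Prop :=
  ∀ L : List Piece, (∀ p ∈ L, PiecePos p) →
    IsRotPacking L (onlineRotPos σ L) (onlineRot σ L)

/-- Perimeter of the bounding box of the packing produced by `σ` on `L`. -/
noncomputable def algRotPeri (σ : List Piece → (ℝ × ℝ) × Bool) (L : List Piece) : ℝ :=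
  periRotCost L (onlineRotPos σ L) (onlineRot σ L)

/-- Area of the bounding box of the packing produced by `σ` on `L`. -/
noncomputable def algRotArea (σ : List Piece → (ℝ × ℝ) × Bool) (L : List Piece) : ℝ :=
  areaRotCost L (onlineRotPos σ L) (onlineRot σ L)

/-! ### Square pieces, bounding-square cost -/

/-- The axis-parallel closed square of side `s` placed at the point `q`. -/
def placedSq (s : ℝ) (q : ℝ × ℝ) : Set (ℝ × ℝ) :=
  Set.Icc q.1 (q.1 + s) ×ˢ Set.Icc q.2 (q.2 + s)

/-- `pos` is a packing of the list `L` of square pieces. -/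
def IsSqPacking (L : List ℝ) (pos : Fin L.length → ℝ × ℝ) : Prop :=
  ∀ i j : Fin L.length, i ≠ j →
    Disjoint (interior (placedSq (L.get i) (pos i)))
             (interior (placedSq (L.get j) (pos j)))

/-- The union of the placed squares. -/
def packedSqSet (L : List ℝ) (pos : Fin L.length → ℝ × ℝ) : Set (ℝ × ℝ) :=
  ⋃ i : Fin L.length, placedSq (L.get i) (pos i)

/-- Area of the smallest axis-parallel square containing all placed squares. -/
noncomputable def sqCost (L : List ℝ) (pos : Fin L.length → ℝ × ℝ) : ℝ :=
  (max (boxWidth (packedSqSet L pos)) (boxHeight (packedSqSet L pos))) ^ 2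

/-- Optimal offline bounding-square area for the square pieces of `L`. -/
noncomputable def optSq (L : List ℝ) : ℝ :=
  sInf { c | ∃ pos : Fin L.length → ℝ × ℝ, IsSqPacking L pos ∧ sqCost L pos = c }

/-- The positions chosen by the online strategy `σ` on the stream `L` of
square pieces. -/
def onlineSqPos (σ : List ℝ → ℝ × ℝ) (L : List ℝ) : Fin L.length → ℝ × ℝ :=
  fun i => σ (L.take ((i : ℕ) + 1))

/-- `σ` is a valid online translation strategy for square pieces. -/
def SqStrategyValid (σ : List ℝ → ℝ × ℝ) : Prop :=
  ∀ L : List ℝ, (∀ s ∈ L, 0 < s) → IsSqPacking L (onlineSqPos σ L)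

/-- Bounding-square area of the packing produced by `σ` on `L`. -/
noncomputable def algSq (σ : List ℝ → ℝ × ℝ) (L : List ℝ) : ℝ :=
  sqCost L (onlineSqPos σ L)

/-! ### The shelf algorithm -/

/-- The piece `p` turned so that its longer edge is horizontal. -/
noncomputable def lay (p : Piece) : Piece := (max p.1 p.2, min p.1 p.2)

theorem orient_decide_lt (p : Piece) : orient p (decide (p.1 < p.2)) = lay p := by
  unfold orient lay
  by_cases h : p.1 < p.2
  · simp [h, h.le]
  · simp [h, not_lt.mp h]

theorem exists_shelf_class (h : ℝ) :
    ∃ j : ℕ, h ≤ 2 ^ j ∧ (1 ≤ h → (2 : ℝ) ^ j ≤ 2 * h) := by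
  by_cases h1 : 1 ≤ h
  · obtain ⟨n, hn, hn'⟩ := exists_nat_pow_near h1 (one_lt_two : (1 : ℝ) < 2)
    exact ⟨n + 1, hn'.le, fun _ => by rw [pow_succ]; linarith⟩
  · exact ⟨0, by simpa using (not_le.mp h1).le, fun h2 => absurd h2 h1⟩

/-- Pieces of height `h` are put on shelves of height `2 ^ shelfClass h`. -/
noncomputable def shelfClass (h : ℝ) : ℕ := (exists_shelf_class h).choose

theorem le_two_pow_shelfClass (h : ℝ) : h ≤ 2 ^ shelfClass h :=
  (exists_shelf_class h).choose_spec.1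

theorem two_pow_shelfClass_le {h : ℝ} (hh : 1 ≤ h) : (2 : ℝ) ^ shelfClass h ≤ 2 * h :=
  (exists_shelf_class h).choose_spec.2 hh

/-- The state of the shelf algorithm. Each class `c` has at most one open shelf, of height `2 ^ c`,
with lower edge at height `base c` and filled up to abscissa `fill c`; the class has an open shelf
if and only if `0 < fill c`. -/
structure ShelfState where
  /-- Total height of all shelves. -/
  top : ℝ
  /-- Longest edge seen so far. -/
  longest : ℝ
  /-- Total area seen so far. -/
  area : ℝ
  /-- Lower edges of the open shelves. -/
  base : ℕ → ℝ
  /-- Occupied widths of the open shelves. -/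
  fill : ℕ → ℝ

namespace ShelfState

/-- The empty state. -/
noncomputable def empty : ShelfState := ⟨0, 0, 0, fun _ => 0, fun _ => 0⟩

/-- The permitted shelf width. -/
noncomputable def bound (s : ShelfState) : ℝ :=
  max (2 * s.longest) (s.area ^ ((3 : ℝ) / 4))

/-- Account for the sizes of a new piece. -/
noncomputable def grow (s : ShelfState) (p : Piece) : ShelfState :=
  { s with longest := max s.longest p.1, area := s.area + p.1 * p.2 }

/-- The piece fits on the open shelf of its class. -/
def Fits (s : ShelfState) (p : Piece) : Prop :=
  0 < s.fill (shelfClass p.2) ∧ s.fill (shelfClass p.2) + p.1 ≤ (s.grow p).bound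

open Classical in
/-- The state after placing the piece `p`. -/
noncomputable def step (s : ShelfState) (p : Piece) : ShelfState :=
  if s.Fits p then
    { s.grow p with
      fill := Function.update s.fill (shelfClass p.2) (s.fill (shelfClass p.2) + p.1) }
  else
    { s.grow p with
      top := s.top + 2 ^ shelfClass p.2
      base := Function.update s.base (shelfClass p.2) s.top
      fill := Function.update s.fill (shelfClass p.2) p.1 }

open Classical in
/-- Where the piece `p` is placed. -/
noncomputable def place (s : ShelfState) (p : Piece) : ℝ × ℝ :=
  if s.Fits p then (s.fill (shelfClass p.2), s.base (shelfClass p.2)) else (0, s.top)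

/-- The state after a stream of pieces. -/
noncomputable def run (L : List Piece) : ShelfState :=
  L.foldl (fun s p => s.step (lay p)) empty

theorem run_concat (L : List Piece) (p : Piece) : run (L ++ [p]) = (run L).step (lay p) := by
  simp [run]

@[simp] theorem step_longest (s : ShelfState) (p : Piece) :
    (s.step p).longest = max s.longest p.1 := by
  unfold step; split_ifs <;> rfl

@[simp] theorem step_area (s : ShelfState) (p : Piece) :
    (s.step p).area = s.area + p.1 * p.2 := by
  unfold step; split_ifs <;> rfl

theorem step_bound (s : ShelfState) (p : Piece) : (s.step p).bound = (s.grow p).bound := by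
  simp [bound, grow]

theorem top_le_step (s : ShelfState) (p : Piece) : s.top ≤ (s.step p).top := by
  unfold step
  split_ifs
  · exact le_rfl
  · simp

theorem bound_le_grow {s : ShelfState} (hs : 0 ≤ s.area) {p : Piece} (hp : PiecePos p) :
    s.bound ≤ (s.grow p).bound := by
  have h := mul_pos hp.1 hp.2
  refine max_le_max ?_ (Real.rpow_le_rpow hs ?_ (by norm_num))
  · simp [grow]
  · simp [grow, h.le]

theorem two_mul_le_grow_bound (s : ShelfState) (p : Piece) : 2 * p.1 ≤ (s.grow p).bound :=
  le_max_of_le_left (by simp [grow])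

/-- The open shelves lie below `top` and are pairwise disjoint. -/
structure Inv (s : ShelfState) : Prop where
  area_nonneg : 0 ≤ s.area
  top_nonneg : 0 ≤ s.top
  base_nonneg : ∀ c, 0 < s.fill c → 0 ≤ s.base c
  below : ∀ c, 0 < s.fill c → s.base c + 2 ^ c ≤ s.top
  separated : ∀ c d, c ≠ d → 0 < s.fill c → 0 < s.fill d →
    s.base c + 2 ^ c ≤ s.base d ∨ s.base d + 2 ^ d ≤ s.base c

/-- The piece `p` placed at `q` lies in the current bounding rectangle and avoids the free parts of
all open shelves. -/
structure Housed (s : ShelfState) (p : Piece) (q : ℝ × ℝ) : Prop where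
  left : 0 ≤ q.1
  bottom : 0 ≤ q.2
  right : q.1 + p.1 ≤ s.bound
  under : q.2 + p.2 ≤ s.top
  clear : ∀ c, 0 < s.fill c →
    q.1 + p.1 ≤ s.fill c ∨ q.2 + p.2 ≤ s.base c ∨ s.base c + 2 ^ c ≤ q.2

theorem inv_empty : Inv empty := by
  constructor <;> simp [empty]

theorem Inv.step {s : ShelfState} (hs : s.Inv) {p : Piece} (hp : PiecePos p) :
    (s.step p).Inv := by
  have hpos := mul_pos hp.1 hp.2
  have h2 : (0 : ℝ) < 2 ^ shelfClass p.2 := by positivity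
  refine ⟨by simpa using add_nonneg hs.area_nonneg hpos.le,
    hs.top_nonneg.trans (s.top_le_step p), ?_, ?_, ?_⟩
  · intro c hc
    unfold ShelfState.step at hc ⊢
    split_ifs at hc ⊢ with hf
    · by_cases h : c = shelfClass p.2
      · subst h; exact hs.base_nonneg _ hf.1
      · exact hs.base_nonneg _ (by simpa [h] using hc)
    · by_cases h : c = shelfClass p.2
      · subst h; simpa using hs.top_nonneg
      · simpa [h] using hs.base_nonneg c (by simpa [h] using hc)
  · intro c hc
    unfold ShelfState.step at hc ⊢
    split_ifs at hc ⊢ with hf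
    · by_cases h : c = shelfClass p.2
      · subst h; exact hs.below _ hf.1
      · exact hs.below _ (by simpa [h] using hc)
    · by_cases h : c = shelfClass p.2
      · subst h; simp
      · have := hs.below c (by simpa [h] using hc)
        simp only [Function.update_of_ne h]
        linarith
  · intro c d hcd hc hd
    unfold ShelfState.step at hc hd ⊢
    split_ifs at hc hd ⊢ with hf
    · refine hs.separated c d hcd ?_ ?_
      · by_cases h : c = shelfClass p.2
        · subst h; exact hf.1
        · simpa [h] using hc
      · by_cases h : d = shelfClass p.2
        · subst h; exact hf.1
        · simpa [h] using hd
    · by_cases h : c = shelfClass p.2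
      · have h' : d ≠ shelfClass p.2 := fun e => hcd (h.trans e.symm)
        subst h
        right
        simpa [h'] using hs.below d (by simpa [h'] using hd)
      · by_cases h' : d = shelfClass p.2
        · subst h'
          left
          simpa [h] using hs.below c (by simpa [h] using hc)
        · simpa [h, h'] using hs.separated c d hcd (by simpa [h] using hc) (by simpa [h'] using hd)

theorem Housed.step {s : ShelfState} (hs : s.Inv) {p' : Piece} {q : ℝ × ℝ} (hq : s.Housed p' q)
    {p : Piece} (hp : PiecePos p) : (s.step p).Housed p' q := by
  refine ⟨hq.left, hq.bottom, ?_, hq.under.trans (s.top_le_step p), ?_⟩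
  · rw [step_bound]
    exact hq.right.trans (bound_le_grow hs.area_nonneg hp)
  · intro c hc
    have hw := hp.1
    unfold ShelfState.step at hc ⊢
    split_ifs at hc ⊢ with hf
    · by_cases h : c = shelfClass p.2
      · subst h
        simp only [Function.update_self]
        rcases hq.clear _ hf.1 with h | h | h
        · left; linarith
        · exact Or.inr (Or.inl h)
        · exact Or.inr (Or.inr h)
      · simpa [h, grow] using hq.clear c (by simpa [h] using hc)
    · by_cases h : c = shelfClass p.2
      · subst h
        right; left
        simpa using hq.under
      · simpa [h] using hq.clear c (by simpa [h] using hc)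

theorem Inv.housed_place {s : ShelfState} (hs : s.Inv) {p : Piece} (hp : PiecePos p) :
    (s.step p).Housed p (s.place p) := by
  have hh := le_two_pow_shelfClass p.2
  have hw := hp.1
  have hb := s.two_mul_le_grow_bound p
  constructor
  · unfold place; split_ifs with hf
    · exact hf.1.le
    · exact le_rfl
  · unfold place; split_ifs with hf
    · exact hs.base_nonneg _ hf.1
    · exact hs.top_nonneg
  · rw [step_bound]
    unfold place; split_ifs with hf
    · exact hf.2
    · simp only; linarith
  · unfold place ShelfState.step; split_ifs with hf
    · have := hs.below _ hf.1
      simp only [grow]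
      linarith
    · simp only; linarith
  · intro c hc
    unfold place
    unfold ShelfState.step at hc ⊢
    split_ifs at hc ⊢ with hf
    · by_cases h : c = shelfClass p.2
      · subst h; left; simp
      · right
        have := hs.separated c (shelfClass p.2) h (by simpa [h] using hc) hf.1
        simp only [grow]
        rcases this with h | h
        · exact Or.inr h
        · left; linarith
    · by_cases h : c = shelfClass p.2
      · subst h; left; simp
      · right; right
        simpa [h] using hs.below c (by simpa [h] using hc)

theorem Housed.disjoint_place {s : ShelfState} {p' : Piece} {q : ℝ × ℝ} (hq : s.Housed p' q)
    (p : Piece) :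
    q.1 + p'.1 ≤ (s.place p).1 ∨ q.2 + p'.2 ≤ (s.place p).2 ∨ (s.place p).2 + p.2 ≤ q.2 := by
  have hh := le_two_pow_shelfClass p.2
  unfold place
  split_ifs with hf
  · rcases hq.clear _ hf.1 with h | h | h
    · exact Or.inl h
    · exact Or.inr (Or.inl h)
    · right; right; simp only; linarith
  · exact Or.inr (Or.inl hq.under)

/-! ### The height of the shelves -/

theorem sum_range_update (F : ℕ → ℝ → ℝ) (f : ℕ → ℝ) (v : ℝ) {n c : ℕ} (hc : c < n) :
    ∑ d ∈ Finset.range n, F d (Function.update f c v d) =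
      ∑ d ∈ Finset.range n, F d (f d) - F c (f c) + F c v := by
  have hc' := Finset.mem_range.mpr hc
  rw [← Finset.add_sum_erase _ _ hc', ← Finset.add_sum_erase _ (fun d => F d (f d)) hc']
  have : ∑ d ∈ (Finset.range n).erase c, F d (Function.update f c v d) =
      ∑ d ∈ (Finset.range n).erase c, F d (f d) :=
    Finset.sum_congr rfl fun d hd => by rw [Function.update_of_ne (Finset.ne_of_mem_erase hd)]
  rw [this, Function.update_self]
  ring

/-- The height of all shelves is paid for by the open shelves (at most one per class) and by the
area `u ^ 4` accounted to the closed shelves. -/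
def Paid (n : ℕ) (s : ShelfState) : Prop :=
  (∀ c, 0 ≤ s.fill c) ∧ ∃ u : ℝ, 0 ≤ u ∧
    u ^ 4 + ∑ c ∈ Finset.range n, s.fill c * (2 ^ c / 2) ≤ s.area ∧
    s.top ≤ 16 * u + ∑ c ∈ Finset.range n, if 0 < s.fill c then (2 : ℝ) ^ c else 0

theorem paid_empty (n : ℕ) : Paid n empty :=
  ⟨fun _ => le_rfl, 0, le_rfl, by simp [empty], by simp [empty]⟩

/-- Closing a shelf of height `H` which is at least half full raises the fourth root of the area of
the closed shelves by at least `H / 16`. -/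
theorem exists_fourth_root_add {u A S B H : ℝ} (hu : 0 ≤ u) (hA : 0 < A) (hS : u ^ 4 + A ≤ S)
    (hB : S ^ ((3 : ℝ) / 4) ≤ B) (hH : 0 ≤ H) (hHA : H * B ≤ 4 * A) :
    ∃ v : ℝ, 0 ≤ v ∧ v ^ 4 = u ^ 4 + A ∧ 16 * u + H ≤ 16 * v := by
  have hpos : 0 < u ^ 4 + A := by positivity
  set v := (u ^ 4 + A) ^ ((1 : ℝ) / 4) with hv
  have hv0 : 0 < v := Real.rpow_pos_of_pos hpos _
  have hv4 : v ^ 4 = u ^ 4 + A := by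
    rw [hv, ← Real.rpow_natCast, ← Real.rpow_mul hpos.le]; norm_num
  have hv3 : v ^ 3 ≤ B := by
    refine le_trans ?_ hB
    have : v ^ 3 = (u ^ 4 + A) ^ ((3 : ℝ) / 4) := by
      rw [hv, ← Real.rpow_natCast, ← Real.rpow_mul hpos.le]; norm_num
    rw [this]
    exact Real.rpow_le_rpow hpos.le hS (by norm_num)
  refine ⟨v, hv0.le, hv4, ?_⟩
  have huv : u ≤ v := le_of_pow_le_pow_left₀ (n := 4) (by norm_num) hv0.le (by linarith)
  have h1 : H * v ^ 3 ≤ 4 * (v ^ 4 - u ^ 4) := by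
    have := mul_le_mul_of_nonneg_left hv3 hH
    linarith
  have h2 : v ^ 4 - u ^ 4 ≤ 4 * v ^ 3 * (v - u) := by
    have e : 4 * v ^ 3 * (v - u) - (v ^ 4 - u ^ 4)
        = (v - u) ^ 2 * (3 * v ^ 2 + 2 * u * v + u ^ 2) := by ring
    have : 0 ≤ (v - u) ^ 2 * (3 * v ^ 2 + 2 * u * v + u ^ 2) := by positivity
    linarith
  have h3 : H * v ^ 3 ≤ (16 * (v - u)) * v ^ 3 := by linarith
  have := le_of_mul_le_mul_right h3 (by positivity)
  linarith

theorem Paid.step {n : ℕ} {s : ShelfState} (hs : s.Paid n) {p : Piece} (h1 : 0 < p.1)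
    (h2 : 1 ≤ p.2) (hc : shelfClass p.2 < n) : (s.step p).Paid n := by
  obtain ⟨hfill, u, hu, harea, htop⟩ := hs
  have hcl := two_pow_shelfClass_le h2
  have hB := s.two_mul_le_grow_bound p
  have hBS : (s.area + p.1 * p.2) ^ ((3 : ℝ) / 4) ≤ (s.grow p).bound := le_max_right _ _
  have hstep := step_area s p
  unfold ShelfState.step at *
  set c := shelfClass p.2 with hcdef
  have h2c : (0 : ℝ) < 2 ^ c := by positivity
  have hap : p.1 * (2 ^ c / 2) ≤ p.1 * p.2 := mul_le_mul_of_nonneg_left (by linarith) h1.le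
  have harea_sum : ∀ v, ∑ d ∈ Finset.range n, Function.update s.fill c v d * (2 ^ d / 2) =
      ∑ d ∈ Finset.range n, s.fill d * (2 ^ d / 2) - s.fill c * (2 ^ c / 2) + v * (2 ^ c / 2) :=
    fun v => sum_range_update (fun d x => x * (2 ^ d / 2)) s.fill v hc
  have hopen_sum : ∀ v, 0 < v →
      ∑ d ∈ Finset.range n, (if 0 < Function.update s.fill c v d then (2 : ℝ) ^ d else 0) =
      ∑ d ∈ Finset.range n, (if 0 < s.fill d then (2 : ℝ) ^ d else 0)
        - (if 0 < s.fill c then (2 : ℝ) ^ c else 0) + 2 ^ c := fun v hv => by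
    rw [sum_range_update (fun d x => if 0 < x then (2 : ℝ) ^ d else 0) s.fill v hc, if_pos hv]
  have hnonneg : ∀ v, 0 < v → ∀ d, 0 ≤ Function.update s.fill c v d := fun v hv d => by
    by_cases h : d = c
    · subst h; simpa using hv.le
    · simpa [h] using hfill d
  split_ifs at hstep ⊢ with hf
  · have hf1 : 0 < s.fill c := hf.1
    have hpos : 0 < s.fill c + p.1 := add_pos hf1 h1
    refine ⟨hnonneg _ hpos, u, hu, ?_, ?_⟩
    · simp only [harea_sum] at hstep ⊢
      rw [hstep]
      linarith
    · simp only [hopen_sum _ hpos, if_pos hf1]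
      simp only [grow]
      linarith
  · by_cases h0 : 0 < s.fill c
    · have hlt : (s.grow p).bound < s.fill c + p.1 := by
        by_contra hle
        exact hf ⟨h0, not_lt.mp hle⟩
      have hle : s.fill c * (2 ^ c / 2) ≤ ∑ d ∈ Finset.range n, s.fill d * (2 ^ d / 2) :=
        Finset.single_le_sum (f := fun d => s.fill d * ((2 : ℝ) ^ d / 2))
          (fun d _ => mul_nonneg (hfill d) (by positivity)) (Finset.mem_range.mpr hc)
      have hp0 : 0 ≤ p.1 * p.2 := by positivity
      obtain ⟨v, hv, hv4, hvu⟩ := exists_fourth_root_add (A := s.fill c * (2 ^ c / 2)) hu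
        (by positivity) (by linarith : _ ≤ s.area + p.1 * p.2) hBS h2c.le (by
          have : (2 : ℝ) ^ c * (s.grow p).bound ≤ 2 ^ c * (2 * s.fill c) :=
            mul_le_mul_of_nonneg_left (by linarith) h2c.le
          linarith)
      refine ⟨hnonneg _ h1, v, hv, ?_, ?_⟩
      · simp only [harea_sum] at hstep ⊢
        rw [hstep, hv4]
        linarith
      · simp only [hopen_sum _ h1, if_pos h0]
        linarith
    · have h00 : s.fill c = 0 := le_antisymm (not_lt.mp h0) (hfill c)
      refine ⟨hnonneg _ h1, u, hu, ?_, ?_⟩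
      · simp only [harea_sum] at hstep ⊢
        rw [hstep, h00]
        linarith
      · simp only [hopen_sum _ h1, if_neg h0]
        linarith

end ShelfState

open ShelfState

theorem lay_pos {p : Piece} (hp : PiecePos p) : PiecePos (lay p) :=
  ⟨lt_max_of_lt_left hp.1, lt_min hp.1 hp.2⟩

theorem inv_run {L : List Piece} (hL : ∀ p ∈ L, PiecePos p) : (run L).Inv := by
  induction L using List.reverseRecOn with
  | nil => exact inv_empty
  | append_singleton L p ih =>
    rw [run_concat]
    exact (ih fun q hq => hL q (by simp [hq])).step (lay_pos (hL p (by simp)))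

theorem paid_run {n : ℕ} {L : List Piece} (hL : ∀ p ∈ L, 1 ≤ p.1 ∧ 1 ≤ p.2)
    (hn : ∀ p ∈ L, shelfClass (lay p).2 < n) : (run L).Paid n := by
  induction L using List.reverseRecOn with
  | nil => exact paid_empty n
  | append_singleton L p ih =>
    rw [run_concat]
    have hp := hL p (by simp)
    exact (ih (fun q hq => hL q (by simp [hq])) fun q hq => hn q (by simp [hq])).step
      (lt_max_of_lt_left (by linarith)) (le_min hp.1 hp.2) (hn p (by simp))

theorem area_run (L : List Piece) : (run L).area = (L.map fun p => p.1 * p.2).sum := by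
  induction L using List.reverseRecOn with
  | nil => rfl
  | append_singleton L p ih => simp [run_concat, ih, lay, max_mul_min]

theorem longest_run_le {L : List Piece} {M : ℝ} (hM : 0 ≤ M) (hL : ∀ p ∈ L, (lay p).1 ≤ M) :
    (run L).longest ≤ M := by
  induction L using List.reverseRecOn with
  | nil => exact hM
  | append_singleton L p ih =>
    rw [run_concat, step_longest]
    exact max_le (ih fun q hq => hL q (by simp [hq])) (hL p (by simp))

/-- The online strategy that runs the shelf algorithm. -/
noncomputable def shelfStrategy (L : List Piece) : (ℝ × ℝ) × Bool :=
  ((run L.dropLast).place (lay (L.getLastD 0)),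
    decide ((L.getLastD 0).1 < (L.getLastD 0).2))

theorem shelfStrategy_take (L : List Piece) (i : Fin L.length) :
    shelfStrategy (L.take (i + 1)) =
      ((run (L.take i)).place (lay (L.get i)), decide ((L.get i).1 < (L.get i).2)) := by
  rw [List.take_succ_eq_append_getElem i.2]
  simp only [shelfStrategy, List.dropLast_concat, List.getLastD_concat, List.get_eq_getElem]

theorem housed_run_take {L : List Piece} (hL : ∀ p ∈ L, PiecePos p) (n : ℕ) (hn : n ≤ L.length)
    (i : Fin L.length) (hi : (i : ℕ) < n) :
    (run (L.take n)).Housed (lay (L.get i)) ((run (L.take i)).place (lay (L.get i))) := by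
  induction n with
  | zero => omega
  | succ n ih =>
    have hinv : (run (L.take n)).Inv := inv_run fun p hp => hL p (List.mem_of_mem_take hp)
    rw [List.take_succ_eq_append_getElem (by omega), run_concat]
    rcases Nat.lt_succ_iff_lt_or_eq.mp hi with h | h
    · exact (ih (by omega) h).step hinv (lay_pos (hL _ (List.getElem_mem _)))
    · subst h
      exact hinv.housed_place (lay_pos (hL _ (List.getElem_mem _)))

theorem interior_placedRect (p : Piece) (q : ℝ × ℝ) :
    interior (placedRect p q) = Ioo q.1 (q.1 + p.1) ×ˢ Ioo q.2 (q.2 + p.2) := by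
  rw [placedRect, interior_prod_eq, interior_Icc, interior_Icc]

theorem shelfStrategy_valid : RotStrategyValid shelfStrategy := by
  intro L hL
  have key : ∀ i j : Fin L.length, i < j → Disjoint
      (interior (placedRect (orient (L.get i) (onlineRot shelfStrategy L i))
        (onlineRotPos shelfStrategy L i)))
      (interior (placedRect (orient (L.get j) (onlineRot shelfStrategy L j))
        (onlineRotPos shelfStrategy L j))) := by
    intro i j hij
    have h := (housed_run_take hL j j.2.le i hij).disjoint_place (lay (L.get j))
    simp only [onlineRot, onlineRotPos, shelfStrategy_take, orient_decide_lt, interior_placedRect]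
    rw [Set.disjoint_left]
    rintro ⟨x, y⟩ ⟨⟨_, hx⟩, hy, hy'⟩ ⟨⟨hx2, _⟩, hy2, hy2'⟩
    simp only at *
    rcases h with h | h | h <;> linarith
  intro i j hij
  rcases lt_or_gt_of_ne hij with h | h
  · exact key i j h
  · exact (key j i h).symm

/-! ### Bounding boxes -/

theorem orient_pos {p : Piece} (hp : PiecePos p) (r : Bool) : PiecePos (orient p r) := by
  cases r
  · exact hp
  · exact ⟨hp.2, hp.1⟩

theorem lower_corner_mem {p : Piece} (hp : PiecePos p) (q : ℝ × ℝ) : q ∈ placedRect p q :=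
  ⟨⟨le_rfl, by linarith [hp.1]⟩, le_rfl, by linarith [hp.2]⟩

theorem upper_corner_mem {p : Piece} (hp : PiecePos p) (q : ℝ × ℝ) :
    (q.1 + p.1, q.2 + p.2) ∈ placedRect p q :=
  ⟨⟨by simpa using hp.1.le, le_rfl⟩, by simpa using hp.2.le, le_rfl⟩

theorem packedRotSet_nonempty {L : List Piece} (hne : L ≠ []) (hL : ∀ p ∈ L, PiecePos p)
    (pos : Fin L.length → ℝ × ℝ) (rot : Fin L.length → Bool) :
    (packedRotSet L pos rot).Nonempty := by
  let i : Fin L.length := ⟨0, List.length_pos_of_ne_nil hne⟩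
  exact ⟨pos i, mem_iUnion.mpr ⟨i, lower_corner_mem (orient_pos (hL _ (L.get_mem i)) _) _⟩⟩

theorem boxWidth_le {S : Set (ℝ × ℝ)} (hS : S.Nonempty) {a b : ℝ}
    (h : ∀ z ∈ S, a ≤ z.1 ∧ z.1 ≤ b) : boxWidth S ≤ b - a :=
  sub_le_sub (csSup_le (hS.image _) (by rintro _ ⟨z, hz, rfl⟩; exact (h z hz).2))
    (le_csInf (hS.image _) (by rintro _ ⟨z, hz, rfl⟩; exact (h z hz).1))

theorem boxHeight_le {S : Set (ℝ × ℝ)} (hS : S.Nonempty) {a b : ℝ}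
    (h : ∀ z ∈ S, a ≤ z.2 ∧ z.2 ≤ b) : boxHeight S ≤ b - a :=
  sub_le_sub (csSup_le (hS.image _) (by rintro _ ⟨z, hz, rfl⟩; exact (h z hz).2))
    (le_csInf (hS.image _) (by rintro _ ⟨z, hz, rfl⟩; exact (h z hz).1))

theorem algRotArea_shelfStrategy_le {L : List Piece} (hne : L ≠ []) (hL : ∀ p ∈ L, PiecePos p) :
    algRotArea shelfStrategy L ≤ (run L).bound * (run L).top := by
  have hS := packedRotSet_nonempty hne hL (onlineRotPos shelfStrategy L) (onlineRot shelfStrategy L)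
  have hbox : ∀ z ∈ packedRotSet L (onlineRotPos shelfStrategy L) (onlineRot shelfStrategy L),
      (0 ≤ z.1 ∧ z.1 ≤ (run L).bound) ∧ 0 ≤ z.2 ∧ z.2 ≤ (run L).top := by
    intro z hz
    obtain ⟨i, hi⟩ := mem_iUnion.mp hz
    have h := housed_run_take hL L.length le_rfl i i.2
    rw [List.take_length] at h
    simp only [onlineRot, onlineRotPos, shelfStrategy_take, orient_decide_lt] at hi
    obtain ⟨⟨h1, h2⟩, h3, h4⟩ := hi
    exact ⟨⟨h.left.trans h1, h2.trans h.right⟩, h.bottom.trans h3, h4.trans h.under⟩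
  have hw := boxWidth_le hS fun z hz => (hbox z hz).1
  have hh := boxHeight_le hS fun z hz => (hbox z hz).2
  rw [sub_zero] at hw hh
  obtain ⟨z, hz⟩ := hS
  have hz' := hbox z hz
  have hh0 : 0 ≤ boxHeight (packedRotSet L (onlineRotPos shelfStrategy L)
      (onlineRot shelfStrategy L)) := by
    refine sub_nonneg.mpr ((csInf_le ?_ (mem_image_of_mem _ hz)).trans
      (le_csSup ?_ (mem_image_of_mem _ hz)))
    · exact ⟨0, by rintro _ ⟨z, hz, rfl⟩; exact (hbox z hz).2.1⟩
    · exact ⟨(run L).top, by rintro _ ⟨z, hz, rfl⟩; exact (hbox z hz).2.2⟩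
  exact mul_le_mul hw hh hh0 (hz'.1.1.trans hz'.1.2)

theorem isCompact_placedRect (p : Piece) (q : ℝ × ℝ) : IsCompact (placedRect p q) :=
  isCompact_Icc.prod isCompact_Icc

theorem isCompact_packedRotSet (L : List Piece) (pos : Fin L.length → ℝ × ℝ)
    (rot : Fin L.length → Bool) : IsCompact (packedRotSet L pos rot) :=
  isCompact_iUnion fun _ => isCompact_placedRect _ _

theorem le_boxWidth {S : Set (ℝ × ℝ)} (hS : IsCompact S) {p : Piece} (hp : PiecePos p)
    {q : ℝ × ℝ} (h : placedRect p q ⊆ S) : p.1 ≤ boxWidth S := by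
  have hc := hS.image continuous_fst
  have h3 := csInf_le hc.bddBelow (mem_image_of_mem Prod.fst (h (lower_corner_mem hp q)))
  have h4 := le_csSup hc.bddAbove (mem_image_of_mem Prod.fst (h (upper_corner_mem hp q)))
  unfold boxWidth
  simp only at h4
  linarith

theorem le_boxHeight {S : Set (ℝ × ℝ)} (hS : IsCompact S) {p : Piece} (hp : PiecePos p)
    {q : ℝ × ℝ} (h : placedRect p q ⊆ S) : p.2 ≤ boxHeight S := by
  have hc := hS.image continuous_snd
  have h3 := csInf_le hc.bddBelow (mem_image_of_mem Prod.snd (h (lower_corner_mem hp q)))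
  have h4 := le_csSup hc.bddAbove (mem_image_of_mem Prod.snd (h (upper_corner_mem hp q)))
  unfold boxHeight
  simp only at h4
  linarith

/-! ### Lower bounds for the optimum -/

theorem orient_mul (p : Piece) (r : Bool) : (orient p r).1 * (orient p r).2 = p.1 * p.2 := by
  cases r
  · rfl
  · exact mul_comm _ _

theorem lay_snd_le_orient (p : Piece) (r : Bool) :
    (lay p).2 ≤ (orient p r).1 ∧ (lay p).2 ≤ (orient p r).2 := by
  cases r <;> simp [lay, orient]

theorem lay_fst_le_orient (p : Piece) (r : Bool) :
    (lay p).1 ≤ (orient p r).1 ∨ (lay p).1 ≤ (orient p r).2 := by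
  rcases le_total p.1 p.2 with h | h <;> cases r <;> simp [lay, orient, h]

theorem mul_le_areaRotCost {L : List Piece} (hL : ∀ p ∈ L, PiecePos p)
    (pos : Fin L.length → ℝ × ℝ) (rot : Fin L.length → Bool) {p q : Piece} (hp : p ∈ L)
    (hq : q ∈ L) : (lay p).1 * (lay q).2 ≤ areaRotCost L pos rot := by
  have hS := isCompact_packedRotSet L pos rot
  obtain ⟨i, rfl⟩ := List.get_of_mem hp
  obtain ⟨j, rfl⟩ := List.get_of_mem hq
  have hi : placedRect (orient (L.get i) (rot i)) (pos i) ⊆ packedRotSet L pos rot :=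
    subset_iUnion (fun i => placedRect (orient (L.get i) (rot i)) (pos i)) i
  have hj : placedRect (orient (L.get j) (rot j)) (pos j) ⊆ packedRotSet L pos rot :=
    subset_iUnion (fun i => placedRect (orient (L.get i) (rot i)) (pos i)) j
  have hip := orient_pos (hL _ hp) (rot i)
  have hjp := orient_pos (hL _ hq) (rot j)
  have hi1 := le_boxWidth hS hip hi
  have hi2 := le_boxHeight hS hip hi
  have hj1 := le_boxWidth hS hjp hj
  have hj2 := le_boxHeight hS hjp hj
  have hs := lay_snd_le_orient (L.get j) (rot j)
  have h0 := lay_pos (hL _ hq)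
  unfold areaRotCost
  rcases lay_fst_le_orient (L.get i) (rot i) with h | h
  · exact mul_le_mul (h.trans hi1) (hs.2.trans hj2) h0.2.le (hip.1.le.trans hi1)
  · rw [mul_comm]
    exact mul_le_mul (hs.1.trans hj1) (h.trans hi2) (lay_pos (hL _ hp)).1.le (hjp.1.le.trans hj1)

theorem volume_interior_placedRect (p : Piece) (q : ℝ × ℝ) (hp : PiecePos p) :
    MeasureTheory.volume (interior (placedRect p q)) = ENNReal.ofReal (p.1 * p.2) := by
  rw [interior_placedRect, MeasureTheory.Measure.volume_eq_prod, MeasureTheory.Measure.prod_prod,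
    Real.volume_Ioo, Real.volume_Ioo, ENNReal.ofReal_mul hp.1.le]
  simp

theorem volume_le_boxArea {S : Set (ℝ × ℝ)} (hS : IsCompact S) (hne : S.Nonempty) :
    MeasureTheory.volume S ≤ ENNReal.ofReal (boxWidth S * boxHeight S) := by
  have h1 := hS.image continuous_fst
  have h2 := hS.image continuous_snd
  have hsub : S ⊆ Icc (sInf (Prod.fst '' S)) (sSup (Prod.fst '' S)) ×ˢ
      Icc (sInf (Prod.snd '' S)) (sSup (Prod.snd '' S)) := fun z hz =>
    ⟨⟨csInf_le h1.bddBelow (mem_image_of_mem _ hz), le_csSup h1.bddAbove (mem_image_of_mem _ hz)⟩,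
      csInf_le h2.bddBelow (mem_image_of_mem _ hz), le_csSup h2.bddAbove (mem_image_of_mem _ hz)⟩
  obtain ⟨z, hz⟩ := hne
  have h0 : 0 ≤ boxWidth S := sub_nonneg.mpr ((hsub hz).1.1.trans (hsub hz).1.2)
  refine (MeasureTheory.measure_mono hsub).trans (le_of_eq ?_)
  rw [MeasureTheory.Measure.volume_eq_prod, MeasureTheory.Measure.prod_prod,
    Real.volume_Icc, Real.volume_Icc, ENNReal.ofReal_mul h0]
  rfl

theorem sum_le_areaRotCost {L : List Piece} (hne : L ≠ []) (hL : ∀ p ∈ L, PiecePos p)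
    {pos : Fin L.length → ℝ × ℝ} {rot : Fin L.length → Bool} (h : IsRotPacking L pos rot) :
    (L.map fun p => p.1 * p.2).sum ≤ areaRotCost L pos rot := by
  have hpos : ∀ i, PiecePos (orient (L.get i) (rot i)) := fun i =>
    orient_pos (hL _ (L.get_mem i)) _
  have hcost : 0 ≤ areaRotCost L pos rot := by
    obtain ⟨p, hp⟩ := List.exists_mem_of_ne_nil L hne
    have h0 := lay_pos (hL p hp)
    exact (mul_pos h0.1 h0.2).le.trans (mul_le_areaRotCost hL pos rot hp hp)
  have hsum : (L.map fun p => p.1 * p.2).sum =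
      ∑ i, (orient (L.get i) (rot i)).1 * (orient (L.get i) (rot i)).2 := by
    simp only [orient_mul]
    exact (Fin.sum_univ_fun_getElem L fun p => p.1 * p.2).symm
  rw [← ENNReal.ofReal_le_ofReal_iff hcost, hsum,
    ENNReal.ofReal_sum_of_nonneg fun i _ => (mul_pos (hpos i).1 (hpos i).2).le]
  calc ∑ i, ENNReal.ofReal ((orient (L.get i) (rot i)).1 * (orient (L.get i) (rot i)).2)
      = ∑ i, MeasureTheory.volume (interior (placedRect (orient (L.get i) (rot i)) (pos i))) :=
        Finset.sum_congr rfl fun i _ => (volume_interior_placedRect _ _ (hpos i)).symm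
    _ = MeasureTheory.volume
          (⋃ i, interior (placedRect (orient (L.get i) (rot i)) (pos i))) := by
        rw [MeasureTheory.measure_iUnion (fun i j hij => h i j hij)
          (fun i => isOpen_interior.measurableSet), tsum_fintype]
    _ ≤ MeasureTheory.volume (packedRotSet L pos rot) :=
        MeasureTheory.measure_mono (iUnion_mono fun _ => interior_subset)
    _ ≤ _ := volume_le_boxArea (isCompact_packedRotSet L pos rot)
        (packedRotSet_nonempty hne hL pos rot)

theorem le_optRotArea {L : List Piece} (hL : ∀ p ∈ L, PiecePos p) {a : ℝ}
    (h : ∀ pos rot, IsRotPacking L pos rot → a ≤ areaRotCost L pos rot) : a ≤ optRotArea L :=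
  le_csInf ⟨_, _, _, shelfStrategy_valid L hL, rfl⟩ (by
    rintro _ ⟨pos, rot, hp, rfl⟩
    exact h pos rot hp)

/-- The final estimate: `A` bounds the area `S`, and the products of longest edge `W` and of the
edges `k ≤ l` of a piece of the highest shelf class. -/
theorem box_bound {A S W k l u T Y : ℝ} (hk : 1 ≤ k) (hkl : k ≤ l) (hlk : l * k ≤ A) (hS0 : 0 ≤ S)
    (hS : S ≤ A) (hW : W * k ≤ A) (huS : u ^ 4 ≤ S) (hT : T ≤ 2 * k)
    (hY : Y ≤ 16 * u + 2 * T) :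
    max (2 * W) (S ^ ((3 : ℝ) / 4)) * Y ≤ 40 * A ^ ((5 : ℝ) / 4) := by
  have hA : 1 ≤ A := by nlinarith
  have hA0 : 0 ≤ A := by linarith
  set a := A ^ ((1 : ℝ) / 4) with ha
  have ha1 : 1 ≤ a := Real.one_le_rpow hA (by norm_num)
  have ha4 : a ^ 4 = A := by rw [ha, ← Real.rpow_natCast, ← Real.rpow_mul hA0]; norm_num
  have ha5 : A ^ ((5 : ℝ) / 4) = a ^ 5 := by
    rw [ha, ← Real.rpow_natCast, ← Real.rpow_mul hA0]; norm_num
  have ha3 : S ^ ((3 : ℝ) / 4) ≤ a ^ 3 := by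
    have : a ^ 3 = A ^ ((3 : ℝ) / 4) := by
      rw [ha, ← Real.rpow_natCast, ← Real.rpow_mul hA0]; norm_num
    rw [this]
    exact Real.rpow_le_rpow hS0 hS (by norm_num)
  have hua : u ≤ a := le_of_pow_le_pow_left₀ (n := 4) (by norm_num) (by linarith) (by linarith)
  have hka : k ≤ a ^ 2 := by
    refine le_of_pow_le_pow_left₀ (n := 2) (by norm_num) (by positivity) ?_
    nlinarith
  have hY' : Y ≤ 16 * a + 4 * k := by linarith
  have hYn : 0 ≤ 16 * a + 4 * k := by linarith
  have h45 : a ^ 4 ≤ a ^ 5 := pow_le_pow_right₀ ha1 (by norm_num)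
  rw [ha5]
  have hm0 : 0 ≤ max (2 * W) (S ^ ((3 : ℝ) / 4)) := le_max_of_le_right (Real.rpow_nonneg hS0 _)
  refine (mul_le_mul_of_nonneg_left hY' hm0).trans ?_
  rw [max_mul_of_nonneg _ _ hYn]
  refine max_le ?_ ?_
  · have hWA : W ≤ a ^ 4 := by
      rcases le_total W 0 with h | h
      · exact h.trans (by positivity)
      · nlinarith
    have := mul_le_mul_of_nonneg_right hWA (by linarith : (0 : ℝ) ≤ a)
    nlinarith
  · refine (mul_le_mul_of_nonneg_right ha3 hYn).trans ?_
    have := mul_le_mul_of_nonneg_left hka (by positivity : (0 : ℝ) ≤ a ^ 3)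
    nlinarith

theorem shelfStrategy_competitive {L : List Piece} (hne : L ≠ [])
    (hL : ∀ q ∈ L, 1 ≤ q.1 ∧ 1 ≤ q.2) :
    algRotArea shelfStrategy L ≤ 40 * optRotArea L ^ ((5 : ℝ) / 4) := by
  have hpos : ∀ p ∈ L, PiecePos p := fun p hp =>
    ⟨by linarith [(hL p hp).1], by linarith [(hL p hp).2]⟩
  refine (algRotArea_shelfStrategy_le hne hpos).trans ?_
  obtain ⟨p, hp, hmax⟩ := L.toFinset.exists_max_image (fun p => shelfClass (lay p).2)
    (by simpa using hne)
  simp only [List.mem_toFinset] at hp hmax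
  have hk : 1 ≤ (lay p).2 := le_min (hL p hp).1 (hL p hp).2
  have hprod : ∀ q ∈ L, (lay q).1 * (lay p).2 ≤ optRotArea L := fun q hq =>
    le_optRotArea hpos fun pos rot _ => mul_le_areaRotCost hpos pos rot hq hp
  have hS : (run L).area ≤ optRotArea L := by
    rw [area_run]
    exact le_optRotArea hpos fun pos rot h => sum_le_areaRotCost hne hpos h
  have hlk := hprod p hp
  have hl := (lay_pos (hpos p hp)).1
  have hA : 0 ≤ optRotArea L := le_trans (by positivity) hlk
  have hW : (run L).longest * (lay p).2 ≤ optRotArea L := by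
    rw [← le_div_iff₀ (by linarith)]
    refine longest_run_le (by positivity) fun q hq => ?_
    rw [le_div_iff₀ (by linarith)]
    exact hprod q hq
  obtain ⟨hfill, u, -, harea, htop⟩ := paid_run hL (n := shelfClass (lay p).2 + 1)
    fun q hq => Nat.lt_succ_of_le (hmax q hq)
  have hsum : 0 ≤ ∑ c ∈ Finset.range (shelfClass (lay p).2 + 1),
      (run L).fill c * ((2 : ℝ) ^ c / 2) :=
    Finset.sum_nonneg fun c _ => mul_nonneg (hfill c) (by positivity)
  have hopen : ∑ c ∈ Finset.range (shelfClass (lay p).2 + 1),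
      (if 0 < (run L).fill c then (2 : ℝ) ^ c else 0) ≤ 2 * 2 ^ shelfClass (lay p).2 := by
    calc _ ≤ ∑ c ∈ Finset.range (shelfClass (lay p).2 + 1), (2 : ℝ) ^ c :=
          Finset.sum_le_sum fun c _ => by split_ifs <;> simp
      _ ≤ _ := by
          rw [geom_sum_eq (by norm_num), pow_succ]
          linarith
  exact box_bound (u := u) hk min_le_max hlk (inv_run hpos).area_nonneg hS hW (by linarith)
    (two_pow_shelfClass_le hk) (by linarith)

/-- There exist a constant `C > 0` and a valid online rotation
strategy `σ` such that for every nonempty finite stream `L` of pieces, all of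
whose edge lengths are at least 1, `ALG_σ(L) ≤ C * OPT(L)^(5/4)` (area of the
bounding box, rotations by 90° allowed). -/
theorem area_rotation_fourth_root_opt_upper_bound :
    ∃ C : ℝ, 0 < C ∧ ∃ σ : List Piece → (ℝ × ℝ) × Bool, RotStrategyValid σ ∧
      ∀ L : List Piece, L ≠ [] → (∀ q ∈ L, 1 ≤ q.1 ∧ 1 ≤ q.2) →
        algRotArea σ L ≤ C * optRotArea L ^ ((5 : ℝ) / 4) := by
  exact ⟨40, by norm_num, shelfStrategy, shelfStrategy_valid,
    fun _ hne hL => shelfStrategy_competitive hne hL⟩
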